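/- Let G be a finite simple graph on [d] = {1,...,d} that has an odd antihole, i.e., an induced subgraph C on vertices {i_1,...,i_{2ℓ+1}} (ℓ ≥ 2) whose complement is an odd cycle of length 2ℓ+1. Then for every finite partially ordered set P on [d], the polytope Ω(O_P, Q_G) = conv((O_P × {1}) ∪ ((−Q_G) × {−1})) ⊂ ℝ^{d+1} does not have the integer decomposition property; in fact the lattice point c = −(e_{i_1} + ... + e_{i_{2ℓ+1}} + ℓ·e_{d+1}) lies in (ℓ+1)·Ω(O_P, Q_G) but is not a sum of ℓ+1 lattice points of Ω(O_P, Q_G). -/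

import Mathlib

open scoped Pointwise

namespace HibiTsuchiya

/-- A point of `ℝ^n` is a *lattice point* if all of its coordinates are integers. -/
def IsLatticePoint {n : ℕ} (x : Fin n → ℝ) : Prop := ∀ i, ∃ z : ℤ, x i = (z : ℝ)

/-- The dual polytope `P^∨ = {x : ⟨x,y⟩ ≤ 1 for all y ∈ P}`. -/
def dualPolytope {n : ℕ} (P : Set (Fin n → ℝ)) : Set (Fin n → ℝ) :=
  {x | ∀ y ∈ P, ∑ i, x i * y i ≤ 1}

/-- A polytope `P ⊆ ℝ^n` is *reflexive* if the origin is an interior point of `P` and the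
dual polytope of `P` is again a lattice polytope (i.e. the convex hull of finitely many
lattice points). -/
def IsReflexive {n : ℕ} (P : Set (Fin n → ℝ)) : Prop :=
  0 ∈ interior P ∧
    ∃ V : Finset (Fin n → ℝ), (∀ v ∈ V, IsLatticePoint v) ∧
      dualPolytope P = convexHull ℝ (V : Set (Fin n → ℝ))

/-- `P` has the *integer decomposition property* if every lattice point of `m • P` (`m ≥ 1`)
is a sum of `m` lattice points of `P`. -/
def HasIDP {n : ℕ} (P : Set (Fin n → ℝ)) : Prop :=
  ∀ m : ℕ, 0 < m → ∀ a : Fin n → ℝ, IsLatticePoint a → a ∈ (m : ℝ) • P →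
    ∃ f : Fin m → Fin n → ℝ, (∀ k, f k ∈ P ∧ IsLatticePoint (f k)) ∧ a = ∑ k, f k

/-- The indicator vector `ρ(S) = ∑_{j ∈ S} e_j` of a subset `S ⊆ [n]`. -/
noncomputable def indicator {n : ℕ} (S : Set (Fin n)) : Fin n → ℝ :=
  S.indicator (fun _ => (1 : ℝ))

/-- A poset ideal of a partial order `P` on `[n]`. -/
def IsPosetIdeal {n : ℕ} (P : PartialOrder (Fin n)) (I : Set (Fin n)) : Prop :=
  ∀ i ∈ I, ∀ j, P.le j i → j ∈ I

/-- The order polytope `O_P`: the convex hull of the indicator vectors of poset ideals. -/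
noncomputable def orderPolytope {n : ℕ} (P : PartialOrder (Fin n)) : Set (Fin n → ℝ) :=
  convexHull ℝ {x | ∃ I : Set (Fin n), IsPosetIdeal P I ∧ x = indicator I}

/-- An antichain of a partial order `P` on `[n]`: a pairwise incomparable subset. -/
def IsPosetAntichain {n : ℕ} (P : PartialOrder (Fin n)) (A : Set (Fin n)) : Prop :=
  ∀ i ∈ A, ∀ j ∈ A, i ≠ j → ¬ P.le i j ∧ ¬ P.le j i

/-- The chain polytope `C_P`: the convex hull of the indicator vectors of antichains. -/
noncomputable def chainPolytope {n : ℕ} (P : PartialOrder (Fin n)) : Set (Fin n → ℝ) :=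
  convexHull ℝ {x | ∃ A : Set (Fin n), IsPosetAntichain P A ∧ x = indicator A}

/-- A stable (independent) set of a graph. -/
def IsStableSet {V : Type*} (G : SimpleGraph V) (S : Set V) : Prop :=
  ∀ i ∈ S, ∀ j ∈ S, ¬ G.Adj i j

/-- The stable set polytope `Q_G`: the convex hull of the indicator vectors of stable sets. -/
noncomputable def stableSetPolytope {n : ℕ} (G : SimpleGraph (Fin n)) : Set (Fin n → ℝ) :=
  convexHull ℝ {x | ∃ S : Set (Fin n), IsStableSet G S ∧ x = indicator S}

/-- The clique number of a graph, as an extended natural number. -/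
noncomputable def cliqueNumber {V : Type*} (G : SimpleGraph V) : ℕ∞ :=
  ⨆ (t : Finset V) (_ : G.IsClique (t : Set V)), (t.card : ℕ∞)

/-- A graph is *perfect* if for every induced subgraph (including the graph itself)
the chromatic number equals the clique number. -/
def IsPerfectGraph {V : Type*} (G : SimpleGraph V) : Prop :=
  ∀ s : Set V, (G.induce s).chromaticNumber = cliqueNumber (G.induce s)

/-- A simplicial complex on the vertex set `[n]`. -/
def IsSimplicialComplex {n : ℕ} (Δ : Set (Finset (Fin n))) : Prop :=
  (∀ i : Fin n, {i} ∈ Δ) ∧ ∀ F ∈ Δ, ∀ F' ⊆ F, F' ∈ Δ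

/-- The polytope `P_Δ`: the convex hull of the indicator vectors of the faces of `Δ`. -/
noncomputable def complexPolytope {n : ℕ} (Δ : Set (Finset (Fin n))) : Set (Fin n → ℝ) :=
  convexHull ℝ {x | ∃ F ∈ Δ, x = indicator (↑F : Set (Fin n))}

/-- `Γ(P,Q) = conv(P ∪ (−Q))`. -/
noncomputable def gammaPolytope {n : ℕ} (P Q : Set (Fin n → ℝ)) : Set (Fin n → ℝ) :=
  convexHull ℝ (P ∪ -Q)

/-- `Ω(P,Q) = conv((P × {1}) ∪ ((−Q) × {−1})) ⊆ ℝ^{n+1}`. -/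
noncomputable def omegaPolytope {n : ℕ} (P Q : Set (Fin n → ℝ)) : Set (Fin (n+1) → ℝ) :=
  convexHull ℝ
    ((fun x : Fin n → ℝ => Fin.snoc x (1 : ℝ)) '' P ∪
     (fun x : Fin n → ℝ => Fin.snoc x (-1 : ℝ)) '' (-Q))

/-- The adjacency relation of the cycle of length `m` on `ZMod m`. -/
def cycleAdj (m : ℕ) (i j : ZMod m) : Prop := i ≠ j ∧ (j = i + 1 ∨ i = j + 1)

/-- `G` has an *odd hole*: an induced odd cycle of length `2ℓ+1 ≥ 5`. -/
def HasOddHole {n : ℕ} (G : SimpleGraph (Fin n)) : Prop :=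
  ∃ ℓ : ℕ, 2 ≤ ℓ ∧ ∃ f : ZMod (2 * ℓ + 1) → Fin n, Function.Injective f ∧
    ∀ i j, G.Adj (f i) (f j) ↔ cycleAdj (2 * ℓ + 1) i j

/-- `G` has an *odd antihole*: an induced subgraph whose complement is an odd cycle of
length `2ℓ+1 ≥ 5`. -/
def HasOddAntihole {n : ℕ} (G : SimpleGraph (Fin n)) : Prop :=
  ∃ ℓ : ℕ, 2 ≤ ℓ ∧ ∃ f : ZMod (2 * ℓ + 1) → Fin n, Function.Injective f ∧
    ∀ i j, G.Adj (f i) (f j) ↔ (i ≠ j ∧ ¬ cycleAdj (2 * ℓ + 1) i j)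

lemma omega_lower {n : ℕ} (P : PartialOrder (Fin n)) (G : SimpleGraph (Fin n))
    (φ : (Fin n → ℝ) →ₗ[ℝ] ℝ) (c : ℝ)
    (h1 : ∀ I : Set (Fin n), 0 ≤ φ (indicator I))
    (h2 : ∀ S : Set (Fin n), IsStableSet G S → φ (indicator S) ≤ c)
    (y : Fin (n+1) → ℝ) (hy : y ∈ omegaPolytope (orderPolytope P) (stableSetPolytope G)) :
    0 ≤ φ (fun i => y i.castSucc) + c / 2 * (1 - y (Fin.last n)) := by
  have hP : orderPolytope P ⊆ {x | 0 ≤ φ x} := by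
    refine convexHull_min ?_ (convex_halfSpace_ge φ.isLinear 0)
    rintro x ⟨I, -, rfl⟩
    exact h1 I
  have hQ : stableSetPolytope G ⊆ {x | φ x ≤ c} := by
    refine convexHull_min ?_ (convex_halfSpace_le φ.isLinear c)
    rintro x ⟨I, hI, rfl⟩
    exact h2 I hI
  have key : omegaPolytope (orderPolytope P) (stableSetPolytope G) ⊆
      {y | -(c/2) ≤ φ (fun i => y i.castSucc) - c / 2 * y (Fin.last n)} := by
    refine convexHull_min ?_ (convex_halfSpace_ge ?_ _)
    · rintro y (⟨x, hx, rfl⟩ | ⟨x, hx, rfl⟩)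
      · have := hP hx
        simp only [Set.mem_ofPred_eq, Fin.snoc_castSucc, Fin.snoc_last] at this ⊢
        linarith
      · have := hQ hx
        simp only [Set.mem_ofPred_eq, Fin.snoc_castSucc, Fin.snoc_last, map_neg] at this ⊢
        have e : φ (fun i => x i) = φ x := rfl
        linarith
    · constructor
      · intro x y
        have e : φ (fun i : Fin n => (x + y) i.castSucc) =
          φ (fun i => x i.castSucc) + φ (fun i => y i.castSucc) := by
          rw [← map_add]; rfl
        rw [e]
        simp only [Pi.add_apply]
        ring
      · intro a x
        have e : φ (fun i : Fin n => (a • x) i.castSucc) =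
          a • φ (fun i => x i.castSucc) := by
          rw [← map_smul]; rfl
        rw [e]
        simp only [Pi.smul_apply, smul_eq_mul]
        ring
  have := key hy
  simp only [Set.mem_ofPred_eq] at this
  linarith

lemma omega_last {n : ℕ} (A B : Set (Fin n → ℝ))
    (y : Fin (n+1) → ℝ) (hy : y ∈ omegaPolytope A B) : -1 ≤ y (Fin.last n) := by
  have key : omegaPolytope A B ⊆ {y | -1 ≤ y (Fin.last n)} := by
    refine convexHull_min ?_ (convex_halfSpace_ge (f := fun y : Fin (n+1) → ℝ => y (Fin.last n))
      ⟨fun _ _ => rfl, fun _ _ => rfl⟩ _)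
    rintro y (⟨x, hx, rfl⟩ | ⟨x, hx, rfl⟩)
    · simp only [Set.mem_ofPred_eq, Fin.snoc_last]; norm_num
    · simp only [Set.mem_ofPred_eq, Fin.snoc_last]; norm_num
  exact key hy

lemma indicator_nonneg' {n : ℕ} (S : Set (Fin n)) (i : Fin n) : 0 ≤ indicator S i :=
  Set.indicator_nonneg (fun _ _ => zero_le_one) i

lemma indicator_le_one' {n : ℕ} (S : Set (Fin n)) (i : Fin n) : indicator S i ≤ 1 := by
  classical
  simp only [indicator, Set.indicator_apply]; split_ifs <;> norm_num

lemma stable_sum_le (d : ℕ) (G : SimpleGraph (Fin d)) (ℓ : ℕ) (hℓ : 2 ≤ ℓ)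
    (f : ZMod (2 * ℓ + 1) → Fin d)
    (hadj : ∀ i j, G.Adj (f i) (f j) ↔ (i ≠ j ∧ ¬ cycleAdj (2 * ℓ + 1) i j))
    (S : Set (Fin d)) (hS : IsStableSet G S) : ∑ k, indicator S (f k) ≤ 2 := by
  classical
  have e : ∑ k, indicator S (f k) = ((Finset.univ.filter (fun k => f k ∈ S)).card : ℝ) := by
    simp [indicator, Set.indicator_apply]
  rw [e]
  have : (Finset.univ.filter (fun k => f k ∈ S)).card ≤ 2 := by
    by_contra! h
    obtain ⟨a, b, c, ha, hb, hc, hab, hac, hbc⟩ := Finset.two_lt_card_iff.1 h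
    simp only [Finset.mem_filter, Finset.mem_univ, true_and] at ha hb hc
    have adj : ∀ i j, f i ∈ S → f j ∈ S → i ≠ j → j = i + 1 ∨ i = j + 1 := by
      intro i j hi hj hij
      have := hS _ hi _ hj
      rw [hadj] at this
      by_contra hcon
      exact this ⟨hij, fun hh => hcon hh.2⟩
    have h3 : (3 : ZMod (2*ℓ+1)) ≠ 0 := by
      intro h0
      have h0' : ((3:ℕ) : ZMod (2*ℓ+1)) = 0 := by exact_mod_cast h0
      rw [ZMod.natCast_eq_zero_iff] at h0'
      have := Nat.le_of_dvd (by norm_num) h0'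
      omega
    rcases adj a b ha hb hab with h1 | h1 <;> rcases adj a c ha hc hac with h2 | h2 <;>
      rcases adj b c hb hc hbc with h4 | h4
    · exact hbc (h1.trans h2.symm)
    · exact hbc (h1.trans h2.symm)
    · exact h3 (by linear_combination -h1 - h2 - h4)
    · exact hac (add_right_cancel (h1.symm.trans h4))
    · exact hab (add_right_cancel (h2.symm.trans h4))
    · exact h3 (by linear_combination -h1 - h2 - h4)
    · exact hbc (add_right_cancel (h1.symm.trans h2))
    · exact hbc (add_right_cancel (h1.symm.trans h2))
  exact_mod_cast this

lemma not_sum (d : ℕ) (G : SimpleGraph (Fin d)) (ℓ : ℕ) (hℓ : 2 ≤ ℓ)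
    (f : ZMod (2 * ℓ + 1) → Fin d)
    (hadj : ∀ i j, G.Adj (f i) (f j) ↔ (i ≠ j ∧ ¬ cycleAdj (2 * ℓ + 1) i j))
    (P : PartialOrder (Fin d)) :
    ¬ ∃ g : Fin (ℓ + 1) → Fin (d + 1) → ℝ,
        (∀ k, g k ∈ omegaPolytope (orderPolytope P) (stableSetPolytope G) ∧
          IsLatticePoint (g k)) ∧
        Fin.snoc (-(indicator (Set.range f))) (-(ℓ : ℝ)) = ∑ k, g k := by
  rintro ⟨g, hg, hsum⟩
  have hlast : ∑ k, g k (Fin.last d) = -(ℓ:ℝ) := by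
    have := congrFun hsum (Fin.last d)
    rw [Fin.snoc_last, Finset.sum_apply] at this
    exact this.symm
  have hcoord : ∀ j, ∑ k, g k (Fin.castSucc (f j)) = -1 := by
    intro j
    have := congrFun hsum (Fin.castSucc (f j))
    rw [Fin.snoc_castSucc, Finset.sum_apply] at this
    rw [← this]
    simp [indicator]
  have hle : ∀ k, g k (Fin.last d) ≤ 0 := by
    intro k
    have h1 : g k (Fin.last d) + 1 ≤ ∑ k, (g k (Fin.last d) + 1) :=
      Finset.single_le_sum (f := fun k => g k (Fin.last d) + 1)
        (fun i _ => by have := omega_last _ _ _ (hg i).1; linarith) (Finset.mem_univ k)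
    rw [Finset.sum_add_distrib, hlast] at h1
    simp at h1
    linarith
  have hs : ∀ k, 2 * g k (Fin.last d) ≤ ∑ j, g k (Fin.castSucc (f j)) := by
    intro k
    obtain ⟨t, ht⟩ := (hg k).2 (Fin.last d)
    have h0 := hle k
    have h1 := omega_last _ _ _ (hg k).1
    rw [ht] at h0 h1
    have h0' : t ≤ 0 := by exact_mod_cast h0
    have h1' : -1 ≤ t := by exact_mod_cast h1
    rcases (by omega : t = 0 ∨ t = -1) with rfl | rfl
    · rw [ht]
      simp only [Int.cast_zero, mul_zero]
      refine Finset.sum_nonneg fun j _ => ?_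
      have := omega_lower P G (LinearMap.proj (f j)) 1 (fun I => indicator_nonneg' _ _)
        (fun S _ => indicator_le_one' _ _) (g k) (hg k).1
      rw [ht] at this
      obtain ⟨z, hz⟩ := (hg k).2 (Fin.castSucc (f j))
      simp only [LinearMap.proj_apply] at this
      rw [hz] at this ⊢
      have h5 : (-1 : ℝ) < z := by norm_num at this; linarith
      have h6 : -1 < z := by exact_mod_cast h5
      have h7 : 0 ≤ z := by omega
      exact_mod_cast h7
    · have := omega_lower P G (∑ j, LinearMap.proj (f j)) 2
        (fun I => by
          simp only [LinearMap.sum_apply, LinearMap.proj_apply]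
          exact Finset.sum_nonneg fun j _ => indicator_nonneg' _ _)
        (fun S hS => by
          simp only [LinearMap.sum_apply, LinearMap.proj_apply]
          exact stable_sum_le d G ℓ hℓ f hadj S hS) (g k) (hg k).1
      rw [ht] at this ⊢
      simp only [LinearMap.sum_apply, LinearMap.proj_apply] at this
      norm_num at this ⊢
      linarith
  have h1 := Finset.sum_le_sum (s := Finset.univ) fun k _ => hs k
  rw [← Finset.mul_sum, hlast, Finset.sum_comm, Finset.sum_congr rfl fun j _ => hcoord j] at h1
  simp [ZMod.card] at h1
  linarith

lemma mem_smul (d : ℕ) (G : SimpleGraph (Fin d)) (ℓ : ℕ) (hℓ : 2 ≤ ℓ)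
    (f : ZMod (2 * ℓ + 1) → Fin d) (hf : Function.Injective f)
    (hadj : ∀ i j, G.Adj (f i) (f j) ↔ (i ≠ j ∧ ¬ cycleAdj (2 * ℓ + 1) i j))
    (P : PartialOrder (Fin d)) :
    (Fin.snoc (-(indicator (Set.range f))) (-(ℓ : ℝ)) : Fin (d+1) → ℝ) ∈
      ((ℓ : ℝ) + 1) • omegaPolytope (orderPolytope P) (stableSetPolytope G) := by
  classical
  set Ω := omegaPolytope (orderPolytope P) (stableSetPolytope G) with hΩ
  have hconv : Convex ℝ Ω := convex_convexHull _ _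
  have hone : (1 : ZMod (2*ℓ+1)) ≠ 0 := by
    intro h0
    have h0' : ((1:ℕ) : ZMod (2*ℓ+1)) = 0 := by exact_mod_cast h0
    rw [ZMod.natCast_eq_zero_iff] at h0'
    have := Nat.le_of_dvd (by norm_num) h0'
    omega
  let S : ZMod (2*ℓ+1) → Set (Fin d) := fun k => {f k, f (k+1)}
  have hS : ∀ k, IsStableSet G (S k) := by
    intro k i hi j hj
    simp only [S, Set.mem_insert_iff, Set.mem_singleton_iff] at hi hj
    rcases hi with rfl | rfl <;> rcases hj with rfl | rfl <;> rw [hadj] <;>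
      simp [cycleAdj, hone]
  have hB : (Fin.snoc (0 : Fin d → ℝ) (1:ℝ) : Fin (d+1) → ℝ) ∈ Ω := by
    refine subset_convexHull _ _ (Or.inl ⟨0, subset_convexHull _ _ ⟨∅, ?_, ?_⟩, rfl⟩)
    · intro i hi; exact hi.elim
    · ext i; simp [indicator]
  have hA : ∀ k, (Fin.snoc (-(indicator (S k))) (-1:ℝ) : Fin (d+1) → ℝ) ∈ Ω := by
    intro k
    refine subset_convexHull _ _ (Or.inr ⟨_, ?_, rfl⟩)
    rw [Set.neg_mem_neg]
    exact subset_convexHull _ _ ⟨S k, hS k, rfl⟩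
  have hl : (0:ℝ) < 2 * ℓ + 1 := by positivity
  have hl' : (0:ℝ) < ℓ + 1 := by positivity
  have hA' : ∑ k, ((1 : ℝ) / (2*ℓ+1)) • (Fin.snoc (-(indicator (S k))) (-1:ℝ) : Fin (d+1) → ℝ)
      ∈ Ω := by
    refine hconv.sum_mem (fun _ _ => by positivity) ?_ (fun k _ => hA k)
    simp [ZMod.card]
    field_simp
  have hy := hconv hA' hB (a := (2*ℓ+1)/(2*(ℓ+1))) (b := 1/(2*(ℓ+1))) (by positivity)
    (by positivity) (by field_simp; ring)
  refine ⟨_, hy, ?_⟩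
  have hind : ∀ j, ∑ k, indicator (S k) j = 2 * indicator (Set.range f) j := by
    intro j
    have e1 : ∀ k, indicator (S k) j = (if f k = j then (1:ℝ) else 0) +
        (if f (k+1) = j then 1 else 0) := by
      intro k
      have hne : f k ≠ f (k+1) := fun h => by simpa [hone] using hf h
      simp only [indicator, Set.indicator_apply, S, Set.mem_insert_iff, Set.mem_singleton_iff]
      by_cases h1 : f k = j
      · have h2 : f (k+1) ≠ j := fun h => hne (h1.trans h.symm)
        simp [h1, h2]
      · by_cases h2 : f (k+1) = j
        · simp [h1, h2, Ne.symm]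
        · simp [h1, h2, Ne.symm h1, Ne.symm h2, eq_comm]
    have e2 : ∑ k, (if f (k+1) = j then (1:ℝ) else 0) = ∑ k, (if f k = j then (1:ℝ) else 0) :=
      Equiv.sum_comp (Equiv.addRight (1 : ZMod (2*ℓ+1))) (fun k => if f k = j then (1:ℝ) else 0)
    have e3 : ∑ k, (if f k = j then (1:ℝ) else 0) = indicator (Set.range f) j := by
      by_cases hj : j ∈ Set.range f
      · obtain ⟨k, rfl⟩ := hj
        simp [indicator, hf.eq_iff]
      · simp only [indicator, Set.indicator_of_notMem hj]
        exact Finset.sum_eq_zero fun k _ => if_neg fun h => hj ⟨k, h⟩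
    rw [Finset.sum_congr rfl fun k _ => e1 k, Finset.sum_add_distrib, e2, e3]
    ring
  ext i
  refine Fin.lastCases ?_ (fun j => ?_) i
  · simp [ZMod.card, -one_div]
    field_simp
    ring
  · simp only [Pi.smul_apply, Pi.add_apply, Finset.sum_apply, Fin.snoc_castSucc, smul_eq_mul,
      Pi.neg_apply, Pi.zero_apply, ← Finset.mul_sum, Finset.sum_neg_distrib, hind]
    field_simp
    ring

/-- If `G` has an odd antihole (an induced subgraph on the vertices `f(0), …, f(2ℓ)`,
`ℓ ≥ 2`, whose complement is an odd cycle of length `2ℓ+1`), then for every poset `P` on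
`[d]` the polytope `Ω(O_P, Q_G)` does not have the integer decomposition property; in fact
the lattice point `c = −(∑_k e_{f(k)} + ℓ e_{d+1})` lies in `(ℓ+1) Ω(O_P, Q_G)` but is not
a sum of `ℓ+1` lattice points of `Ω(O_P, Q_G)`. -/
theorem omega_not_idp_of_oddAntihole (d : ℕ) (G : SimpleGraph (Fin d)) (ℓ : ℕ) (hℓ : 2 ≤ ℓ)
    (f : ZMod (2 * ℓ + 1) → Fin d) (hf : Function.Injective f)
    (hadj : ∀ i j, G.Adj (f i) (f j) ↔ (i ≠ j ∧ ¬ cycleAdj (2 * ℓ + 1) i j))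
    (P : PartialOrder (Fin d)) :
    ¬ HasIDP (omegaPolytope (orderPolytope P) (stableSetPolytope G)) ∧
    (Fin.snoc (-(indicator (Set.range f))) (-(ℓ : ℝ)) ∈
      ((ℓ : ℝ) + 1) • omegaPolytope (orderPolytope P) (stableSetPolytope G)) ∧
    ¬ ∃ g : Fin (ℓ + 1) → Fin (d + 1) → ℝ,
        (∀ k, g k ∈ omegaPolytope (orderPolytope P) (stableSetPolytope G) ∧
          IsLatticePoint (g k)) ∧
        Fin.snoc (-(indicator (Set.range f))) (-(ℓ : ℝ)) = ∑ k, g k := by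
  have h2 := mem_smul d G ℓ hℓ f hf hadj P
  have h3 := not_sum d G ℓ hℓ f hadj P
  refine ⟨fun h => h3 (h (ℓ + 1) (Nat.succ_pos _) _ ?_ ?_), h2, h3⟩
  · intro i
    refine Fin.lastCases ?_ (fun j => ?_) i
    · exact ⟨-ℓ, by simp⟩
    · classical
      refine ⟨-(if j ∈ Set.range f then 1 else 0), ?_⟩
      simp [indicator, Set.indicator_apply]
  · rw [Nat.cast_add, Nat.cast_one]
    exact h2

end HibiTsuchiya
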